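/- arXiv:1209.6145 — 2 statements merged into one kernel-verified Lean document; each statement's English description precedes it below -/
import Mathlib

section
/- Under Assumption A and with the shuffle maps as defined, let n ∈ ℕ and y' ∈ [0,1), and write ⌊M_n y'⌋ = Σ_{j=1}^n b_j M_{j−1} with digits b_j ∈ {0,…,m_j−1} (mixed-radix expansion). Then H*_n( (1/M_n)·Σ_{j=1}^n b_j·(M_n/M_j) + (y' − ⌊M_n y'⌋/M_n) ) = y'; equivalently, (H*_n)^{−1}(y') = Σ_{j=1}^n b_j/M_j + (y' − ⌊M_n y'⌋/M_n). -/
open MeasureTheory Set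

noncomputable section

/-- `R_{M,m} : {0,…,Mm−1} → {0,…,Mm−1}`, `R_{M,m}(i) = M·(i mod m) + ⌊i/m⌋`. -/
def Rmap (M m i : ℕ) : ℕ := M * (i % m) + i / m

/-- One shuffle step `h*_{M,m}` on `[0,1)`:
`h*_{M,m}(y) = R_{M,m}(⌊Mm·y⌋)/(Mm) + (y − ⌊Mm·y⌋/(Mm))`. -/
noncomputable def hstar (M m : ℕ) (y : ℝ) : ℝ :=
  (Rmap M m ⌊(M * m : ℝ) * y⌋₊ : ℝ) / (M * m : ℝ) + (y - (⌊(M * m : ℝ) * y⌋₊ : ℝ) / (M * m : ℝ))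

/-- `M_n := m_1 ⋯ m_n` (so `M_0 = 1`). -/
def Mprod (m : ℕ → ℕ) (n : ℕ) : ℕ := ∏ j ∈ Finset.Icc 1 n, m j

/-- The shuffle `H*_n := h*_{M_{n−1},m_n} ∘ ⋯ ∘ h*_{M_1,m_2} ∘ h*_{M_0,m_1}`, `H*_0 = id`. -/
noncomputable def Hstar (m : ℕ → ℕ) : ℕ → ℝ → ℝ
  | 0 => id
  | n + 1 => hstar (Mprod m n) (m (n + 1)) ∘ Hstar m n

theorem Mprod_succ (m : ℕ → ℕ) (n : ℕ) : Mprod m (n + 1) = Mprod m n * m (n + 1) := by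
  simp [Mprod, Finset.prod_Icc_succ_top]

theorem Mprod_pos {m : ℕ → ℕ} (hm : ∀ n, 1 ≤ n → 0 < m n) (n : ℕ) : 0 < Mprod m n :=
  Finset.prod_pos fun j hj => hm j (Finset.mem_Icc.mp hj).1

/-- `R_{M,m}` swaps the roles of the leading and trailing digits. -/
theorem Rmap_mul_add (M : ℕ) {m a c : ℕ} (hc : c < m) : Rmap M m (m * a + c) = M * c + a := by
  have hm : 0 < m := by omega
  simp [Rmap, Nat.mod_eq_of_lt hc, Nat.mul_add_div hm, Nat.div_eq_of_lt hc]

/-- A shuffle step translates the interval of index `i` onto the one of index `R_{M,m}(i)`. -/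
theorem hstar_div_add {M m : ℕ} (hM : 0 < M) (hm : 0 < m) (i : ℕ) {e : ℝ} (he : 0 ≤ e)
    (he' : (M * m : ℝ) * e < 1) :
    hstar M m ((i : ℝ) / (M * m) + e) = (Rmap M m i : ℝ) / (M * m) + e := by
  have hMm : (0 : ℝ) < M * m := by positivity
  have hfloor : ⌊(M * m : ℝ) * ((i : ℝ) / (M * m) + e)⌋₊ = i := by
    have h : (M * m : ℝ) * ((i : ℝ) / (M * m) + e) = i + M * m * e := by field_simp
    rw [h, Nat.floor_eq_iff (by positivity)]
    constructor
    · nlinarith [mul_nonneg hMm.le he]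
    · linarith
  rw [hstar, hfloor]
  ring

/-- `H*_n` reverses the order of the digits, translating each interval of length `1 / M_n`. -/
theorem Hstar_sum_div_add {m : ℕ → ℕ} (hm : ∀ n, 1 ≤ n → 0 < m n) (b : ℕ → ℕ) (n : ℕ)
    (hb : ∀ j, 1 ≤ j → j ≤ n → b j < m j) {e : ℝ} (he : 0 ≤ e) (he' : (Mprod m n : ℝ) * e < 1) :
    Hstar m n (∑ j ∈ Finset.Icc 1 n, (b j : ℝ) / Mprod m j + e) =
      ((∑ j ∈ Finset.Icc 1 n, b j * Mprod m (j - 1) : ℕ) : ℝ) / Mprod m n + e := by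
  induction n generalizing e with
  | zero => simp [Hstar]
  | succ n ih =>
    have hM := Mprod_pos hm n
    have hm' := hm (n + 1) (by omega)
    have hbn := hb (n + 1) (by omega) le_rfl
    have hMR : (0 : ℝ) < Mprod m n := by exact_mod_cast hM
    have hmR : (0 : ℝ) < m (n + 1) := by exact_mod_cast hm'
    have hbR : (b (n + 1) : ℝ) + 1 ≤ m (n + 1) := by exact_mod_cast hbn
    rw [Mprod_succ, Nat.cast_mul] at he'
    have hlt : (Mprod m n : ℝ) * ((b (n + 1) : ℝ) / (Mprod m n * m (n + 1)) + e) < 1 := by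
      have h : (Mprod m n : ℝ) * ((b (n + 1) : ℝ) / (Mprod m n * m (n + 1)) + e) =
          (b (n + 1) + Mprod m n * m (n + 1) * e) / m (n + 1) := by field_simp
      rw [h, div_lt_one hmR]
      linarith
    rw [Finset.sum_Icc_succ_top (by omega), Finset.sum_Icc_succ_top (by omega), Mprod_succ,
      Nat.cast_mul, add_assoc, Hstar, Function.comp_apply,
      ih (fun j h1 h2 => hb j h1 (by omega)) (by positivity) hlt]
    set A := ∑ j ∈ Finset.Icc 1 n, b j * Mprod m (j - 1)
    have h : (A : ℝ) / Mprod m n + ((b (n + 1) : ℝ) / (Mprod m n * m (n + 1)) + e) =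
        ((m (n + 1) * A + b (n + 1) : ℕ) : ℝ) / (Mprod m n * m (n + 1)) + e := by
      push_cast
      field_simp
      ring
    rw [h, hstar_div_add hM hm' _ he he', Rmap_mul_add _ hbn]
    push_cast
    ring

/-- Remark `remark:explicitHnetoile`: under Assumption A, if
`⌊M_n y'⌋ = ∑_{j=1}^n b_j M_{j−1}` is the mixed-radix expansion (`b_j ∈ {0,…,m_j−1}`), then
`H*_n( (1/M_n)·∑_{j=1}^n b_j·(M_n/M_j) + (y' − ⌊M_n y'⌋/M_n) ) = y'`. -/
theorem shuffle_explicit_inverse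
    (p : ℕ → ℝ) (hp0 : 0 < p 0)
    (m : ℕ → ℕ) (hm : ∀ n, 1 ≤ n → 0 < m n)
    (hpm : ∀ n, p (n + 1) = (m (n + 1) : ℝ) * p n)
    (n : ℕ) (y' : ℝ) (hy' : y' ∈ Set.Ico (0:ℝ) 1)
    (b : ℕ → ℕ) (hb : ∀ j, 1 ≤ j → j ≤ n → b j < m j)
    (hexp : ⌊(Mprod m n : ℝ) * y'⌋₊ = ∑ j ∈ Finset.Icc 1 n, b j * Mprod m (j - 1)) :
    Hstar m n
      ((1 / (Mprod m n : ℝ)) *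
          (∑ j ∈ Finset.Icc 1 n, (b j : ℝ) * ((Mprod m n : ℝ) / (Mprod m j : ℝ)))
        + (y' - (⌊(Mprod m n : ℝ) * y'⌋₊ : ℝ) / (Mprod m n : ℝ))) = y' := by
  have hM : (0 : ℝ) < Mprod m n := by exact_mod_cast Mprod_pos hm n
  have hsum : (1 / (Mprod m n : ℝ)) *
      (∑ j ∈ Finset.Icc 1 n, (b j : ℝ) * ((Mprod m n : ℝ) / (Mprod m j : ℝ))) =
      ∑ j ∈ Finset.Icc 1 n, (b j : ℝ) / Mprod m j := by
    rw [Finset.mul_sum]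
    refine Finset.sum_congr rfl fun j _ => ?_
    field_simp
  have hmul : (Mprod m n : ℝ) * (y' - (⌊(Mprod m n : ℝ) * y'⌋₊ : ℝ) / (Mprod m n : ℝ)) =
      Mprod m n * y' - ⌊(Mprod m n : ℝ) * y'⌋₊ := by field_simp
  have he : 0 ≤ y' - (⌊(Mprod m n : ℝ) * y'⌋₊ : ℝ) / (Mprod m n : ℝ) := by
    rw [sub_nonneg, div_le_iff₀' hM]
    exact Nat.floor_le (mul_nonneg hM.le hy'.1)
  rw [hsum, Hstar_sum_div_add hm b n hb he, ← hexp]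
  · ring
  · rw [hmul]
    linarith [Nat.lt_floor_add_one ((Mprod m n : ℝ) * y')]
end
end

section
/- Suppose m_j = 2 for all j ≥ 1 (so M_n = 2^n). Then for every n ≥ 1 and every y' ∈ [0,1): (H*_n)^{−1}( H*_n(y') + 2^{−n} mod 1 ) equals y' + 3·2^{−(j+1)} − 1 if 1 − 2^{−j} ≤ y' < 1 − 2^{−(j+1)} for some j ∈ {0,…,n−1}, and equals y' − 1 + 2^{−n} if 1 − 2^{−n} ≤ y' < 1. -/
open MeasureTheory Set

noncomputable section

/-- Reversal of the `n` lowest binary digits of `k`. -/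
def binaryReversal : ℕ → ℕ → ℕ
  | 0, _ => 0
  | n + 1, k => 2 ^ n * (k % 2) + binaryReversal n (k / 2)

theorem binaryReversal_lt (n k : ℕ) : binaryReversal n k < 2 ^ n := by
  induction n generalizing k with
  | zero => simp [binaryReversal]
  | succ n ih =>
    have h := ih (k / 2)
    rw [binaryReversal, pow_succ]
    rcases Nat.mod_two_eq_zero_or_one k with hk | hk <;> rw [hk] <;> omega

theorem binaryReversal_zero_right (n : ℕ) : binaryReversal n 0 = 0 := by
  induction n with
  | zero => rfl
  | succ n ih => simp [binaryReversal, ih]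

theorem binaryReversal_succ_of_lt {n k : ℕ} (hk : k < 2 ^ n) :
    binaryReversal (n + 1) k = 2 * binaryReversal n k := by
  induction n generalizing k with
  | zero =>
    obtain rfl : k = 0 := by simpa using hk
    rfl
  | succ n ih =>
    rw [binaryReversal, ih (k := k / 2) (by rw [pow_succ] at hk; omega), binaryReversal]
    ring

theorem binaryReversal_succ_two_pow_add {n k : ℕ} (hk : k < 2 ^ n) :
    binaryReversal (n + 1) (2 ^ n + k) = 2 * binaryReversal n k + 1 := by
  induction n generalizing k with
  | zero =>
    obtain rfl : k = 0 := by simpa using hk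
    rfl
  | succ n ih =>
    have hmod : (2 ^ (n + 1) + k) % 2 = k % 2 := by rw [pow_succ]; omega
    have hdiv : (2 ^ (n + 1) + k) / 2 = 2 ^ n + k / 2 := by rw [pow_succ]; omega
    rw [binaryReversal, hmod, hdiv, ih (k := k / 2) (by rw [pow_succ] at hk; omega),
      binaryReversal]
    ring

theorem binaryReversal_add_one (j p r : ℕ) (hr : r < 2 ^ p) :
    binaryReversal (j + 1 + p) (2 ^ (j + 1 + p) - 2 ^ (p + 1) + r) + 1 =
      binaryReversal (j + 1 + p) (2 ^ p + r) := by
  induction j with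
  | zero =>
    rw [zero_add, add_comm 1 p, Nat.sub_self, zero_add, binaryReversal_succ_of_lt hr,
      binaryReversal_succ_two_pow_add hr]
  | succ j ih =>
    have hle : 2 ^ (p + 1) ≤ 2 ^ (j + 1 + p) := Nat.pow_le_pow_right two_pos (by omega)
    have hp : 2 ^ (p + 1) = 2 * 2 ^ p := by ring
    have hsplit : 2 ^ (j + 1 + p + 1) - 2 ^ (p + 1) + r =
        2 ^ (j + 1 + p) + (2 ^ (j + 1 + p) - 2 ^ (p + 1) + r) := by
      rw [pow_succ 2 (j + 1 + p)]; omega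
    rw [show j + 1 + 1 + p = j + 1 + p + 1 by ring, hsplit,
      binaryReversal_succ_two_pow_add (by omega), binaryReversal_succ_of_lt (by omega), ← ih]
    ring

theorem binaryReversal_two_pow_sub_one (n : ℕ) :
    binaryReversal n (2 ^ n - 1) = 2 ^ n - 1 := by
  induction n with
  | zero => rfl
  | succ n ih =>
    have hpos : 0 < 2 ^ n := by positivity
    rw [show 2 ^ (n + 1) - 1 = 2 ^ n + (2 ^ n - 1) by rw [pow_succ]; omega,
      binaryReversal_succ_two_pow_add (by omega), ih]
    omega

theorem Mprod_two (n : ℕ) : Mprod (fun _ => 2) n = 2 ^ n := by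
  simp [Mprod]

theorem hstar_natCast_add_div {M m : ℕ} (hM : 0 < M) (hm : 0 < m) (i : ℕ) {t : ℝ}
    (ht : t ∈ Ico (0 : ℝ) 1) :
    hstar M m ((i + t) / (M * m)) = (Rmap M m i + t) / (M * m) := by
  have hMm : (M * m : ℝ) ≠ 0 := by positivity
  have hfloor : ⌊(M * m : ℝ) * ((i + t) / (M * m))⌋₊ = i := by
    rw [mul_div_cancel₀ _ hMm, Nat.floor_eq_iff (add_nonneg i.cast_nonneg ht.1)]
    exact ⟨by linarith [ht.1], by linarith [ht.2]⟩
  rw [hstar, hfloor]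
  ring

theorem Hstar_two_natCast_add_div (n k : ℕ) (hk : k < 2 ^ n) {t : ℝ} (ht : t ∈ Ico (0 : ℝ) 1) :
    Hstar (fun _ => 2) n ((k + t) / 2 ^ n) = (binaryReversal n k + t) / 2 ^ n := by
  induction n generalizing k t with
  | zero =>
    obtain rfl : k = 0 := by simpa using hk
    simp [Hstar, binaryReversal]
  | succ n ih =>
    have hkr : (k : ℝ) = 2 * (k / 2 : ℕ) + (k % 2 : ℕ) := by
      exact_mod_cast (Nat.div_add_mod k 2).symm
    have hmod : ((k % 2 : ℕ) : ℝ) ≤ 1 := by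
      exact_mod_cast Nat.le_of_lt_succ (Nat.mod_lt k two_pos)
    have hmod0 : (0 : ℝ) ≤ (k % 2 : ℕ) := Nat.cast_nonneg _
    have hin : ((k : ℝ) + t) / 2 ^ (n + 1) =
        ((k / 2 : ℕ) + ((k % 2 : ℕ) + t) / 2) / 2 ^ n := by
      rw [hkr, pow_succ]; field_simp; ring
    have hmid : ((binaryReversal n (k / 2) : ℝ) + ((k % 2 : ℕ) + t) / 2) / 2 ^ n =
        ((2 * binaryReversal n (k / 2) + k % 2 : ℕ) + t) /
          (((2 ^ n : ℕ) : ℝ) * ((2 : ℕ) : ℝ)) := by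
      push_cast; field_simp; ring
    have hR : Rmap (2 ^ n) 2 (2 * binaryReversal n (k / 2) + k % 2) =
        binaryReversal (n + 1) k := by
      rw [Rmap, binaryReversal]
      congr 2 <;> omega
    rw [hin, Hstar, Function.comp_apply, ih (k / 2) (by rw [pow_succ] at hk; omega)
      ⟨by linarith [ht.1], by linarith [ht.2]⟩, hmid, Mprod_two,
      hstar_natCast_add_div (by positivity) two_pos _ ht, hR, pow_succ]
    push_cast
    rfl

theorem exists_eq_natCast_add_div_two_pow (n : ℕ) {y : ℝ} (hy : y ∈ Ico (0 : ℝ) 1) :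
    ∃ k < 2 ^ n, ∃ t ∈ Ico (0 : ℝ) 1, y = ((k : ℕ) + t) / 2 ^ n := by
  have hpos : (0 : ℝ) < 2 ^ n := by positivity
  have hnn : 0 ≤ y * 2 ^ n := mul_nonneg hy.1 hpos.le
  refine ⟨⌊y * 2 ^ n⌋₊, ?_, y * 2 ^ n - ⌊y * 2 ^ n⌋₊, ⟨?_, ?_⟩, ?_⟩
  · rw [Nat.floor_lt hnn]
    push_cast
    nlinarith [hy.2]
  · linarith [Nat.floor_le hnn]
  · linarith [Nat.lt_floor_add_one (y * 2 ^ n)]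
  · field_simp
    ring

theorem natCast_add_div_two_pow_mem_Ico {n k : ℕ} (hk : k < 2 ^ n) {t : ℝ}
    (ht : t ∈ Ico (0 : ℝ) 1) : ((k : ℝ) + t) / 2 ^ n ∈ Ico (0 : ℝ) 1 := by
  have hk' : (k : ℝ) + 1 ≤ 2 ^ n := by exact_mod_cast hk
  refine ⟨div_nonneg (add_nonneg k.cast_nonneg ht.1) (by positivity), ?_⟩
  rw [div_lt_one (by positivity)]
  linarith [ht.2]

/-- formula `eq:AdjacentPlusBinaryReversal`: with `m_j = 2` for all `j` (so
`M_n = 2^n`), for every `n ≥ 1` and `y' ∈ [0,1)`, the preimage under the bijection `H*_n` of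
`H*_n(y') + 2^{−n} mod 1` is `y' + 3·2^{−(j+1)} − 1` when `1 − 2^{−j} ≤ y' < 1 − 2^{−(j+1)}`
for some `j ∈ {0,…,n−1}`, and is `y' − 1 + 2^{−n}` when `1 − 2^{−n} ≤ y' < 1`. (Being the
preimage in `[0,1)` is expressed by: the stated value lies in `[0,1)` and is mapped by `H*_n`
to `Int.fract (H*_n(y') + 2^{−n})`.) -/
theorem shuffle_adjacent_plus_binary
    (n : ℕ) (hn : 1 ≤ n) (y' : ℝ) (hy' : y' ∈ Set.Ico (0:ℝ) 1) :
    (∀ j : ℕ, j < n →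
      1 - (2:ℝ) ^ (-(j:ℤ)) ≤ y' → y' < 1 - (2:ℝ) ^ (-(j:ℤ) - 1) →
        (y' + 3 * (2:ℝ) ^ (-(j:ℤ) - 1) - 1 ∈ Set.Ico (0:ℝ) 1 ∧
         Hstar (fun _ => 2) n (y' + 3 * (2:ℝ) ^ (-(j:ℤ) - 1) - 1)
           = Int.fract (Hstar (fun _ => 2) n y' + (2:ℝ) ^ (-(n:ℤ))))) ∧
    (1 - (2:ℝ) ^ (-(n:ℤ)) ≤ y' →
      (y' - 1 + (2:ℝ) ^ (-(n:ℤ)) ∈ Set.Ico (0:ℝ) 1 ∧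
       Hstar (fun _ => 2) n (y' - 1 + (2:ℝ) ^ (-(n:ℤ)))
         = Int.fract (Hstar (fun _ => 2) n y' + (2:ℝ) ^ (-(n:ℤ))))) := by
  obtain ⟨k, hk, t, ht, rfl⟩ := exists_eq_natCast_add_div_two_pow n hy'
  have hpos : (0 : ℝ) < 2 ^ n := by positivity
  have hn2 : (2 : ℝ) ^ (-(n : ℤ)) = 1 / 2 ^ n := by rw [zpow_neg, zpow_natCast, one_div]
  rw [hn2, Hstar_two_natCast_add_div n k hk ht]
  constructor
  · intro j hj hlo hhi
    obtain ⟨p, rfl⟩ : ∃ p, n = j + 1 + p := ⟨n - (j + 1), by omega⟩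
    have hj2 : (2 : ℝ) ^ (-(j : ℤ)) = 2 ^ (p + 1) / 2 ^ (j + 1 + p) := by
      rw [zpow_neg, zpow_natCast]; field_simp; ring
    have hj2' : (2 : ℝ) ^ (-(j : ℤ) - 1) = 2 ^ p / 2 ^ (j + 1 + p) := by
      rw [zpow_sub_one₀ two_ne_zero, zpow_neg, zpow_natCast]; field_simp; ring
    rw [hj2, one_sub_div hpos.ne', div_le_div_iff_of_pos_right hpos] at hlo
    rw [hj2', one_sub_div hpos.ne', div_lt_div_iff_of_pos_right hpos] at hhi
    have hlo' : 2 ^ (j + 1 + p) < k + 1 + 2 ^ (p + 1) := by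
      rify; linarith [ht.2]
    have hhi' : k + 2 ^ p < 2 ^ (j + 1 + p) := by
      rify; linarith [ht.1]
    have hle : 2 ^ (p + 1) ≤ 2 ^ (j + 1 + p) := Nat.pow_le_pow_right two_pos (by omega)
    have hp : 2 ^ (p + 1) = 2 * 2 ^ p := by ring
    obtain ⟨r, rfl⟩ : ∃ r, k = 2 ^ (j + 1 + p) - 2 ^ (p + 1) + r :=
      ⟨k - (2 ^ (j + 1 + p) - 2 ^ (p + 1)), by omega⟩
    have hr : r < 2 ^ p := by omega
    have hlt : 2 ^ p + r < 2 ^ (j + 1 + p) := by omega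
    have hrev := binaryReversal_add_one j p r hr
    have htarget : (((2 ^ (j + 1 + p) - 2 ^ (p + 1) + r : ℕ) : ℝ) + t) / 2 ^ (j + 1 + p) +
        3 * (2 ^ p / 2 ^ (j + 1 + p)) - 1 = ((2 ^ p + r : ℕ) + t) / 2 ^ (j + 1 + p) := by
      rw [Nat.cast_add, Nat.cast_sub hle]
      push_cast
      rw [pow_succ 2 p]
      field_simp
      ring
    have hsum (a : ℕ) : ((a : ℝ) + t) / 2 ^ (j + 1 + p) + 1 / 2 ^ (j + 1 + p) =
        ((a + 1 : ℕ) + t) / 2 ^ (j + 1 + p) := by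
      push_cast; ring
    rw [hj2', htarget, Hstar_two_natCast_add_div _ _ hlt ht, hsum, hrev, eq_comm,
      Int.fract_eq_self]
    exact ⟨natCast_add_div_two_pow_mem_Ico hlt ht,
      natCast_add_div_two_pow_mem_Ico (binaryReversal_lt _ _) ht⟩
  · intro hlo
    rw [one_sub_div hpos.ne', div_le_div_iff_of_pos_right hpos] at hlo
    have hlo' : 2 ^ n < k + 2 := by
      rify; linarith [ht.2]
    have hone : 1 ≤ 2 ^ n := Nat.one_le_two_pow
    obtain rfl : k = 2 ^ n - 1 := by omega
    have htarget : (((2 ^ n - 1 : ℕ) : ℝ) + t) / 2 ^ n - 1 + 1 / 2 ^ n =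
        ((0 : ℕ) + t) / 2 ^ n := by
      rw [Nat.cast_sub hone]; push_cast; field_simp; ring
    have hsum : (((2 ^ n - 1 : ℕ) : ℝ) + t) / 2 ^ n + 1 / 2 ^ n =
        ((0 : ℕ) + t) / 2 ^ n + 1 := by
      rw [Nat.cast_sub hone]; push_cast; field_simp; ring
    have hmem := natCast_add_div_two_pow_mem_Ico (n := n) (k := 0) (by positivity) ht
    rw [htarget, Hstar_two_natCast_add_div n 0 (by positivity) ht, binaryReversal_zero_right,
      binaryReversal_two_pow_sub_one, hsum, Int.fract_add_one, eq_comm, Int.fract_eq_self]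
    exact ⟨hmem, hmem⟩
end
end
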